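/- For all integers m ≥ 1 and n ≥ 1, the double integral ∫_0^m ∫_0^s K_{n+1}(s)²·I_n(t)²·s·t dt ds is bounded both by m²/(4n) and by m; moreover, for n = 0 and every integer m ≥ 1, ∫_0^m ∫_0^s K_1(s)²·I_0(t)²·s·t dt ds ≤ m. -/

import Mathlib

open MeasureTheory Real intervalIntegral

/-- Modified Bessel function of the first kind of integer order `n`:
`I_n(t) = (1/π) ∫_0^π exp(t cos α) cos(n α) dα`. -/
noncomputable def besselI (n : ℤ) (t : ℝ) : ℝ :=
  (1 / Real.pi) * ∫ α in (0:ℝ)..Real.pi, Real.exp (t * Real.cos α) * Real.cos ((n : ℝ) * α)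

/-- Modified Bessel function of the second kind of integer order `n`:
`K_n(t) = ∫_0^∞ exp(−t cosh α) cosh(n α) dα`. -/
noncomputable def besselK (n : ℤ) (t : ℝ) : ℝ :=
  ∫ α in Set.Ioi (0:ℝ), Real.exp (-t * Real.cosh α) * Real.cosh ((n : ℝ) * α)

open Filter Topology

lemma besselI_hasDerivAt (n : ℤ) (t : ℝ) :
    HasDerivAt (besselI n) ((besselI (n - 1) t + besselI (n + 1) t) / 2) t := by
  have key := intervalIntegral.hasDerivAt_integral_of_dominated_loc_of_deriv_le
    (μ := volume) (a := 0) (b := Real.pi) (x₀ := t) (s := Metric.ball t 1)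
    (F := fun x α => Real.exp (x * Real.cos α) * Real.cos ((n : ℝ) * α))
    (F' := fun x α => Real.exp (x * Real.cos α) * Real.cos α * Real.cos ((n : ℝ) * α))
    (bound := fun _ => Real.exp (|t| + 1))
    (Metric.ball_mem_nhds t one_pos)
    (Eventually.of_forall fun x => (by fun_prop : Continuous _).aestronglyMeasurable)
    ((by fun_prop : Continuous _).intervalIntegrable _ _)
    (by exact (by fun_prop : Continuous _).aestronglyMeasurable)
    (by
      refine Eventually.of_forall fun α _ x hx => ?_
      rw [Metric.mem_ball, Real.dist_eq] at hx
      have hx' : |x| ≤ |t| + 1 := by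
        have := abs_sub_abs_le_abs_sub x t
        linarith
      rw [norm_mul, norm_mul, Real.norm_eq_abs, Real.norm_eq_abs, Real.norm_eq_abs, Real.abs_exp]
      have h1 := Real.abs_cos_le_one α
      have h2 := Real.abs_cos_le_one ((n : ℝ) * α)
      have h3 : x * Real.cos α ≤ |t| + 1 := by
        calc x * Real.cos α ≤ |x * Real.cos α| := le_abs_self _
          _ = |x| * |Real.cos α| := abs_mul _ _
          _ ≤ |x| * 1 := by gcongr
          _ ≤ _ := by linarith
      calc _ ≤ Real.exp (|t| + 1) * 1 * 1 := by gcongr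
        _ = _ := by ring)
    (by simp)
    (by
      refine Eventually.of_forall fun α _ x hx => ?_
      have := (((hasDerivAt_id x).mul_const (Real.cos α)).exp).mul_const (Real.cos ((n : ℝ) * α))
      simpa using this)
  have h := key.2.const_mul (1 / Real.pi)
  refine h.congr_deriv (Eq.symm ?_)
  simp only [besselI]
  rw [← mul_add, ← intervalIntegral.integral_add, mul_div_assoc, ← intervalIntegral.integral_div]
  · congr 2
    ext α
    push_cast
    rw [sub_mul, add_mul, Real.cos_sub, Real.cos_add]
    ring_nf
  · exact (by fun_prop : Continuous _).intervalIntegrable _ _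
  · exact (by fun_prop : Continuous _).intervalIntegrable _ _

lemma besselI_rec (n : ℤ) (t : ℝ) :
    t * (besselI (n - 1) t - besselI (n + 1) t) = 2 * n * besselI n t := by
  have h := intervalIntegral.integral_eq_sub_of_hasDerivAt (a := 0) (b := Real.pi)
    (f := fun α => Real.exp (t * Real.cos α) * Real.sin ((n : ℝ) * α))
    (f' := fun α => n * (Real.exp (t * Real.cos α) * Real.cos ((n : ℝ) * α))
      - t / 2 * (Real.exp (t * Real.cos α) * Real.cos (((n - 1 : ℤ) : ℝ) * α)
        - Real.exp (t * Real.cos α) * Real.cos (((n + 1 : ℤ) : ℝ) * α)))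
    (by
      intro α _
      have h1 := ((Real.hasDerivAt_cos α).const_mul t).exp.mul
        (((hasDerivAt_id α).const_mul (n : ℝ)).sin)
      refine h1.congr_deriv (Eq.symm ?_)
      push_cast
      rw [sub_mul, add_mul, Real.cos_sub, Real.cos_add]
      simp only [id, one_mul]
      ring)
    ((by fun_prop : Continuous _).intervalIntegrable _ _)
  rw [intervalIntegral.integral_sub, intervalIntegral.integral_const_mul,
    intervalIntegral.integral_const_mul, intervalIntegral.integral_sub] at h
  · simp only [Real.sin_int_mul_pi, mul_zero, Real.sin_zero, sub_zero] at h
    simp only [besselI]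
    linear_combination (-2 / Real.pi) * h
  all_goals exact (by fun_prop : Continuous _).intervalIntegrable _ _

lemma besselI_cont (n : ℤ) : Continuous (besselI n) :=
  continuous_iff_continuousAt.2 fun t => (besselI_hasDerivAt n t).continuousAt

lemma besselI_nonneg (n : ℕ) : ∀ t : ℝ, 0 < t → 0 ≤ besselI n t := by
  induction n with
  | zero =>
    intro t _
    simp only [besselI]
    refine mul_nonneg (by positivity) (intervalIntegral.integral_nonneg Real.pi_pos.le ?_)
    intro α _
    simp [Real.exp_nonneg]
  | succ n ih =>
    intro t ht
    have hd : ∀ x : ℝ, HasDerivAt (fun x => x ^ (n + 1) * besselI ((n : ℤ) + 1) x)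
        (x ^ (n + 1) * besselI n x) x := by
      intro x
      have h1 := (hasDerivAt_pow (n + 1) x).mul (besselI_hasDerivAt ((n : ℤ) + 1) x)
      refine h1.congr_deriv (Eq.symm ?_)
      have h2 := besselI_rec ((n : ℤ) + 1) x
      rw [add_sub_cancel_right] at h2 ⊢
      push_cast at h2 ⊢
      try simp only [add_tsub_cancel_right]
      linear_combination (x ^ n / 2) * h2
    have hm : MonotoneOn (fun x => x ^ (n + 1) * besselI ((n : ℤ) + 1) x) (Set.Ici 0) := by
      refine monotoneOn_of_hasDerivWithinAt_nonneg (convex_Ici 0)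
        (f' := fun x => x ^ (n + 1) * besselI n x)
        (fun x _ => (hd x).continuousAt.continuousWithinAt)
        (fun x _ => (hd x).hasDerivWithinAt) ?_
      intro x hx
      rw [interior_Ici, Set.mem_Ioi] at hx
      have := ih x hx
      positivity
    have := hm (Set.mem_Ici.2 le_rfl) (Set.mem_Ici.2 ht.le) ht.le
    simp only [ne_eq, Nat.add_eq_zero_iff, one_ne_zero, and_false, not_false_eq_true, zero_pow, zero_mul] at this
    push_cast
    exact nonneg_of_mul_nonneg_right this (by positivity)

lemma besselI_sq_int (n : ℕ) (s : ℝ) (hs : 0 < s) :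
    ∫ t in (0:ℝ)..s, besselI n t ^ 2 * t ≤ s * besselI n s * besselI ((n : ℤ) + 1) s := by
  have hd : ∀ x : ℝ, HasDerivAt (fun x => x * besselI n x * besselI ((n : ℤ) + 1) x)
      (x * (besselI n x ^ 2 + besselI ((n : ℤ) + 1) x ^ 2)) x := by
    intro x
    have h1 := ((hasDerivAt_id x).mul (besselI_hasDerivAt (n : ℤ) x)).mul
      (besselI_hasDerivAt ((n : ℤ) + 1) x)
    refine h1.congr_deriv (Eq.symm ?_)
    have h2 := besselI_rec ((n : ℤ) + 1) x
    have h3 := besselI_rec (n : ℤ) x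
    rw [add_sub_cancel_right] at h2 ⊢
    push_cast at h2 h3
    simp only [id, Pi.mul_apply]
    linear_combination (besselI n x / 2) * h2 - (besselI (n + 1) x / 2) * h3
  have c1 := besselI_cont n
  have c2 := besselI_cont (n + 1)
  have h := intervalIntegral.integral_eq_sub_of_hasDerivAt (a := 0) (b := s)
    (fun x _ => hd x) ((by fun_prop : Continuous _).intervalIntegrable _ _)
  have : ∫ t in (0:ℝ)..s, besselI n t ^ 2 * t ≤
      ∫ x in (0:ℝ)..s, x * (besselI n x ^ 2 + besselI ((n : ℤ) + 1) x ^ 2) := by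
    refine intervalIntegral.integral_mono_on hs.le
      ((by fun_prop : Continuous _).intervalIntegrable _ _)
      ((by fun_prop : Continuous _).intervalIntegrable _ _) ?_
    intro x hx
    have := mul_nonneg hx.1 (sq_nonneg (besselI ((n : ℤ) + 1) x))
    linarith
  rw [h] at this
  simpa using this

lemma expcosh_bound (e k a : ℝ) (he : 0 < e) (ha : 0 ≤ a) :
    Real.exp (-e * Real.cosh a) * Real.exp (|k| * a) ≤
      Real.exp ((|k| + 1) ^ 2 / e) * Real.exp (-1 * a) := by
  rw [← Real.exp_add, ← Real.exp_add, Real.exp_le_exp]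
  have h1 : a ^ 2 / 4 ≤ Real.cosh a := by
    rw [Real.cosh_eq]
    have := Real.quadratic_le_exp_of_nonneg ha
    have := Real.exp_pos (-a)
    linarith
  have h2 : e * (a ^ 2 / 4) ≤ e * Real.cosh a := by gcongr
  have h3 : (|k| + 1) * a ≤ (|k| + 1) ^ 2 / e + e * (a ^ 2 / 4) := by
    rw [← sub_nonneg]
    have : (|k| + 1) ^ 2 / e + e * (a ^ 2 / 4) - (|k| + 1) * a
        = ((|k| + 1) - e * a / 2) ^ 2 / e := by field_simp; ring
    rw [this]; positivity
  linarith

lemma cosh_le_exp (k a : ℝ) (ha : 0 ≤ a) : Real.cosh (k * a) ≤ Real.exp (|k| * a) := by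
  rw [← Real.cosh_abs, abs_mul, abs_of_nonneg ha, Real.cosh_eq]
  have : Real.exp (-(|k| * a)) ≤ Real.exp (|k| * a) := by
    rw [Real.exp_le_exp]
    have : 0 ≤ |k| * a := by positivity
    linarith
  linarith

lemma besselK_bound (e k a : ℝ) (he : 0 < e) (ha : 0 ≤ a) :
    Real.exp (-e * Real.cosh a) * Real.cosh (k * a) ≤
      Real.exp ((|k| + 1) ^ 2 / e) * Real.exp (-1 * a) :=
  (mul_le_mul_of_nonneg_left (cosh_le_exp k a ha) (Real.exp_nonneg _)).trans
    (expcosh_bound e k a he ha)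

lemma besselK_integrable (e k : ℝ) (he : 0 < e) :
    IntegrableOn (fun a => Real.exp (-e * Real.cosh a) * Real.cosh (k * a)) (Set.Ioi 0) := by
  refine integrable_of_isBigO_exp_neg one_pos (by fun_prop) ?_
  refine Asymptotics.IsBigO.of_bound (Real.exp ((|k| + 1) ^ 2 / e)) ?_
  filter_upwards [eventually_ge_atTop 0] with a ha
  rw [Real.norm_of_nonneg (by have := Real.cosh_pos (k * a); positivity),
    Real.norm_of_nonneg (Real.exp_nonneg _)]
  exact besselK_bound e k a he ha

lemma besselK_nonneg (n : ℤ) (s : ℝ) : 0 ≤ besselK n s :=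
  integral_nonneg fun a => by have := Real.cosh_pos (n * a); positivity

lemma besselK_mono (n : ℕ) (s : ℝ) (hs : 0 < s) : besselK n s ≤ besselK ((n : ℤ) + 1) s := by
  refine setIntegral_mono_on (besselK_integrable _ _ hs) (besselK_integrable _ _ hs)
    measurableSet_Ioi ?_
  intro a ha
  have ha : 0 < a := ha
  gcongr
  rw [Real.cosh_le_cosh, abs_of_nonneg (by positivity), abs_of_nonneg (by positivity)]
  push_cast
  nlinarith

lemma besselK_hasDerivAt (n : ℤ) (s : ℝ) (hs : 0 < s) :
    HasDerivAt (besselK n) (-(besselK (n + 1) s + besselK (n - 1) s) / 2) s := by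
  have hprod : ∀ a : ℝ, Real.cosh a * Real.cosh (n * a) =
      (Real.cosh (((n + 1 : ℤ) : ℝ) * a) + Real.cosh (((n - 1 : ℤ) : ℝ) * a)) / 2 := by
    intro a
    push_cast
    rw [sub_mul, add_mul, Real.cosh_sub, Real.cosh_add]
    ring_nf
  have key := hasDerivAt_integral_of_dominated_loc_of_deriv_le
    (μ := volume.restrict (Set.Ioi (0:ℝ))) (x₀ := s) (s := Set.Ioi (s / 2))
    (F := fun x a => Real.exp (-x * Real.cosh a) * Real.cosh ((n : ℝ) * a))
    (F' := fun x a => -((Real.exp (-x * Real.cosh a) * Real.cosh (((n + 1 : ℤ) : ℝ) * a)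
      + Real.exp (-x * Real.cosh a) * Real.cosh (((n - 1 : ℤ) : ℝ) * a)) / 2))
    (bound := fun a => (Real.exp (-(s / 2) * Real.cosh a) * Real.cosh (((n + 1 : ℤ) : ℝ) * a)
      + Real.exp (-(s / 2) * Real.cosh a) * Real.cosh (((n - 1 : ℤ) : ℝ) * a)) / 2)
    (Ioi_mem_nhds (by linarith))
    (Eventually.of_forall fun x => (by fun_prop : Continuous _).aestronglyMeasurable)
    (besselK_integrable _ _ hs)
    (by exact (by fun_prop : Continuous _).aestronglyMeasurable)
    (by
      refine Eventually.of_forall fun a x hx => ?_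
      have hx : s / 2 < x := hx
      have h0 := Real.cosh_pos a
      have h1 := Real.cosh_pos (((n + 1 : ℤ) : ℝ) * a)
      have h2 := Real.cosh_pos (((n - 1 : ℤ) : ℝ) * a)
      rw [norm_neg, Real.norm_of_nonneg (by positivity)]
      gcongr)
    (((besselK_integrable _ _ (by linarith)).add (besselK_integrable _ _ (by linarith))).div_const 2)
    (by
      refine Eventually.of_forall fun a x hx => ?_
      have h1 := (((hasDerivAt_id x).neg.mul_const (Real.cosh a)).exp).mul_const
        (Real.cosh ((n : ℝ) * a))
      refine h1.congr_deriv (Eq.symm ?_)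
      simp only [Pi.neg_apply, id]
      linear_combination Real.exp (-x * Real.cosh a) * hprod a)
  have h := key.2
  refine h.congr_deriv (Eq.symm ?_)
  rw [MeasureTheory.integral_neg, MeasureTheory.integral_div, MeasureTheory.integral_add (besselK_integrable _ _ hs) (besselK_integrable _ _ hs)]
  simp only [besselK]
  ring

lemma besselK_rec (n : ℤ) (s : ℝ) (hs : 0 < s) :
    s * (besselK (n + 1) s - besselK (n - 1) s) = 2 * n * besselK n s := by
  have i0 := besselK_integrable s n hs
  have i1 := besselK_integrable s ((n + 1 : ℤ) : ℝ) hs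
  have i2 := besselK_integrable s ((n - 1 : ℤ) : ℝ) hs
  have h := integral_Ioi_of_hasDerivAt_of_tendsto' (a := 0) (m := 0)
    (f := fun a => Real.exp (-s * Real.cosh a) * Real.sinh ((n : ℝ) * a))
    (f' := fun a => n * (Real.exp (-s * Real.cosh a) * Real.cosh ((n : ℝ) * a))
      - s / 2 * (Real.exp (-s * Real.cosh a) * Real.cosh (((n + 1 : ℤ) : ℝ) * a)
        - Real.exp (-s * Real.cosh a) * Real.cosh (((n - 1 : ℤ) : ℝ) * a)))
    (by
      intro a _
      have h1 := ((Real.hasDerivAt_cosh a).const_mul (-s)).exp.mul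
        (((hasDerivAt_id a).const_mul (n : ℝ)).sinh)
      refine h1.congr_deriv (Eq.symm ?_)
      push_cast
      rw [sub_mul, add_mul, Real.cosh_sub, Real.cosh_add]
      simp only [id, one_mul]
      ring)
    ((i0.const_mul _).sub ((i1.sub i2).const_mul _))
    (by
      have hz : Tendsto (fun a : ℝ => Real.exp ((|(n : ℝ)| + 1) ^ 2 / s) * Real.exp (-1 * a))
          atTop (𝓝 0) := by
        have : Tendsto (fun a : ℝ => Real.exp (-1 * a)) atTop (𝓝 0) := by
          simpa using Real.tendsto_exp_neg_atTop_nhds_zero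
        simpa using this.const_mul (Real.exp ((|(n : ℝ)| + 1) ^ 2 / s))
      refine squeeze_zero_norm' ?_ hz
      filter_upwards [eventually_ge_atTop 0] with a ha
      refine le_trans ?_ (besselK_bound s n a hs ha)
      rw [norm_mul, Real.norm_of_nonneg (Real.exp_nonneg _)]
      gcongr
      rw [Real.norm_eq_abs, abs_le]
      have := Real.sinh_lt_cosh (n * a)
      have h2 := Real.sinh_lt_cosh (-(n * a))
      rw [Real.sinh_neg, Real.cosh_neg] at h2
      constructor <;> linarith)
  have i3 : IntegrableOn (fun a => s / 2 * (Real.exp (-s * Real.cosh a) *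
      Real.cosh (((n + 1 : ℤ) : ℝ) * a)
        - Real.exp (-s * Real.cosh a) * Real.cosh (((n - 1 : ℤ) : ℝ) * a))) (Set.Ioi 0) :=
    (i1.sub i2).const_mul _
  rw [MeasureTheory.integral_sub (i0.const_mul _) i3, MeasureTheory.integral_const_mul,
    MeasureTheory.integral_const_mul, MeasureTheory.integral_sub i1 i2] at h
  simp only [mul_zero, Real.sinh_zero, sub_zero] at h
  simp only [besselK]
  linear_combination -2 * h

lemma besselK_one_le (s : ℝ) (hs : 0 < s) : s * besselK 1 s ≤ 1 := by
  have hd : ∀ x ∈ Set.Ici (0:ℝ), HasDerivAt (fun a => -Real.exp (-s * Real.sinh a))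
      (s * (Real.exp (-s * Real.sinh x) * Real.cosh x)) x := by
    intro x _
    have h1 := (((Real.hasDerivAt_sinh x).const_mul (-s)).exp).neg
    refine h1.congr_deriv ?_
    ring
  have hpos : ∀ x ∈ Set.Ioi (0:ℝ), 0 ≤ s * (Real.exp (-s * Real.sinh x) * Real.cosh x) := by
    intro x _
    have := Real.cosh_pos x
    positivity
  have hlim : Tendsto (fun a => -Real.exp (-s * Real.sinh a)) atTop (𝓝 0) := by
    have h1 : Tendsto Real.sinh atTop atTop := by
      refine tendsto_atTop_mono' _ ?_ tendsto_id
      filter_upwards [eventually_ge_atTop 0] with a ha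
      exact Real.self_le_sinh_iff.2 ha
    have h2 : Tendsto (fun a => -s * Real.sinh a) atTop atBot :=
      h1.const_mul_atTop_of_neg (by linarith)
    simpa using (Real.tendsto_exp_atBot.comp h2).neg
  have hi := integrableOn_Ioi_deriv_of_nonneg' hd hpos hlim
  have h := integral_Ioi_of_hasDerivAt_of_nonneg' hd hpos hlim
  simp only [Real.sinh_zero, mul_zero, Real.exp_zero, sub_neg_eq_add, zero_add] at h
  rw [← h]
  simp only [besselK]
  rw [← MeasureTheory.integral_const_mul]
  refine setIntegral_mono_on ((besselK_integrable _ _ hs).const_mul _) hi measurableSet_Ioi ?_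
  intro a _
  have h1 := Real.cosh_pos a
  have h2 := (Real.sinh_lt_cosh a).le
  simp only [Int.cast_one, one_mul]
  have h3 : Real.exp (-s * Real.cosh a) ≤ Real.exp (-s * Real.sinh a) := by
    rw [Real.exp_le_exp]
    nlinarith
  gcongr

lemma besselI_neg (n : ℤ) (t : ℝ) : besselI (-n) t = besselI n t := by
  simp [besselI]

lemma besselK_neg (n : ℤ) (t : ℝ) : besselK (-n) t = besselK n t := by
  simp [besselK]

lemma wronskian_zero_le (s : ℝ) (hs : 0 < s) :
    s * (besselI 0 s * besselK 1 s + besselI 1 s * besselK 0 s) ≤ 1 := by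
  set W : ℝ → ℝ := fun x => x * (besselI 0 x * besselK 1 x + besselI 1 x * besselK 0 x) with hW
  have hd : ∀ x ∈ Set.Ioi (0:ℝ), HasDerivAt W 0 x := by
    intro x hx
    have hx : 0 < x := hx
    have h1 := (hasDerivAt_id x).mul
      (((besselI_hasDerivAt 0 x).mul (besselK_hasDerivAt 1 x hx)).add
        ((besselI_hasDerivAt 1 x).mul (besselK_hasDerivAt 0 x hx)))
    refine h1.congr_deriv ?_
    have e1 := besselI_rec 1 x
    have e2 := besselK_rec 1 x hx
    have n1 := besselI_neg 1 x
    have n2 := besselK_neg 1 x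
    norm_num at e1 e2 n1 n2 ⊢
    rw [n1, n2]
    linear_combination (-besselI 0 x / 2) * e2 + (-besselK 0 x / 2) * e1
  have hconst : ∀ x ∈ Set.Ioi (0:ℝ), W s = W x := by
    intro x hx
    exact isOpen_Ioi.is_const_of_deriv_eq_zero isPreconnected_Ioi
      (fun y hy => (hd y hy).differentiableAt.differentiableWithinAt)
      (fun y hy => (hd y hy).deriv) hs hx
  have hle : ∀ x ∈ Set.Ioi (0:ℝ), W s ≤ besselI 0 x + besselI 1 x := by
    intro x hx
    rw [hconst x hx]
    have hx : 0 < x := hx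
    have k1 := besselK_one_le x hx
    have k0 : x * besselK 0 x ≤ 1 := by
      have := besselK_mono 0 x hx
      norm_num at this
      nlinarith
    have i0 := besselI_nonneg 0 x hx
    have i1 := besselI_nonneg 1 x hx
    norm_num at i0 i1
    simp only [hW]
    nlinarith [mul_le_mul_of_nonneg_left k1 i0, mul_le_mul_of_nonneg_left k0 i1]
  have hI0 : besselI 0 0 = 1 := by
    simp [besselI, Real.pi_ne_zero]
  have hI1 : besselI 1 0 = 0 := by
    have := besselI_rec 1 0
    norm_num at this
    exact this
  have hc : Tendsto (fun x => besselI 0 x + besselI 1 x) (𝓝[>] 0) (𝓝 1) := by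
    have := ((besselI_cont 0).add (besselI_cont 1)).tendsto 0
    rw [Pi.add_apply, hI0, hI1, add_zero] at this
    exact this.mono_left nhdsWithin_le_nhds
  exact ge_of_tendsto hc (eventually_mem_nhdsWithin.mono hle)

lemma wronskian_le (n : ℕ) (s : ℝ) (hs : 0 < s) :
    s * (besselI n s * besselK ((n : ℤ) + 1) s + besselI ((n : ℤ) + 1) s * besselK n s) ≤ 1 := by
  induction n with
  | zero => simpa using wronskian_zero_le s hs
  | succ n ih =>
    refine le_of_eq_of_le ?_ ih
    have e1 := besselI_rec ((n : ℤ) + 1) s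
    have e2 := besselK_rec ((n : ℤ) + 1) s hs
    rw [add_sub_cancel_right] at e1 e2
    push_cast at e1 e2 ⊢
    linear_combination besselI ((n : ℤ) + 1) s * e2 - besselK ((n : ℤ) + 1) s * e1

lemma IK_le (n : ℕ) (s : ℝ) (hs : 0 < s) :
    s * (besselI n s * besselK ((n : ℤ) + 1) s) ≤ 1 := by
  have h := wronskian_le n s hs
  have i1 := besselI_nonneg (n + 1) s hs
  push_cast at i1
  have := mul_nonneg hs.le (mul_nonneg i1 (besselK_nonneg n s))
  linarith

lemma inner_bounds (n : ℕ) (s : ℝ) (hs : 0 < s) :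
    0 ≤ (∫ t in (0:ℝ)..s, (besselK ((n : ℤ) + 1) s) ^ 2 * (besselI n t) ^ 2 * s * t) ∧
    (∫ t in (0:ℝ)..s, (besselK ((n : ℤ) + 1) s) ^ 2 * (besselI n t) ^ 2 * s * t)
      ≤ s / (2 * (n + 1)) ∧
    (∫ t in (0:ℝ)..s, (besselK ((n : ℤ) + 1) s) ^ 2 * (besselI n t) ^ 2 * s * t) ≤ 1 := by
  have heq : (∫ t in (0:ℝ)..s, (besselK ((n : ℤ) + 1) s) ^ 2 * (besselI n t) ^ 2 * s * t)
      = (besselK ((n : ℤ) + 1) s) ^ 2 * s * ∫ t in (0:ℝ)..s, besselI n t ^ 2 * t := by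
    rw [← intervalIntegral.integral_const_mul]
    congr 1
    ext t
    ring
  have hK := besselK_nonneg ((n : ℤ) + 1) s
  have hI := besselI_nonneg n s hs
  have hI1 := besselI_nonneg (n + 1) s hs
  have hI2 := besselI_nonneg (n + 2) s hs
  have a1 := IK_le n s hs
  have a2 := IK_le (n + 1) s hs
  have hKm := besselK_mono (n + 1) s hs
  have e1 := besselI_rec ((n : ℤ) + 1) s
  rw [add_sub_cancel_right, add_assoc, one_add_one_eq_two] at e1
  push_cast at hI1 hI2 a2 hKm e1
  have hle : (∫ t in (0:ℝ)..s, (besselK ((n : ℤ) + 1) s) ^ 2 * (besselI n t) ^ 2 * s * t)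
      ≤ (s * (besselI n s * besselK ((n : ℤ) + 1) s)) *
        (s * (besselI ((n : ℤ) + 1) s * besselK ((n : ℤ) + 1) s)) := by
    rw [heq]
    calc _ ≤ (besselK ((n : ℤ) + 1) s) ^ 2 * s * (s * besselI n s * besselI ((n : ℤ) + 1) s) := by
          gcongr
          exact besselI_sq_int n s hs
      _ = _ := by ring
  have hp : 0 ≤ s * (besselI ((n : ℤ) + 1) s * besselK ((n : ℤ) + 1) s) := by positivity
  have hle2 := hle.trans (mul_le_of_le_one_left hp a1)
  refine ⟨?_, hle2.trans ?_, hle2.trans ?_⟩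
  · refine intervalIntegral.integral_nonneg hs.le fun t ht => ?_
    have := ht.1
    positivity
  · have h1 : besselI ((n : ℤ) + 1) s ≤ s / (2 * (n + 1)) * besselI n s := by
      rw [div_mul_eq_mul_div, le_div_iff₀ (by positivity)]
      nlinarith [mul_nonneg hs.le hI2]
    calc _ ≤ s * ((s / (2 * (n + 1)) * besselI n s) * besselK ((n : ℤ) + 1) s) := by gcongr
      _ = s / (2 * (n + 1)) * (s * (besselI n s * besselK ((n : ℤ) + 1) s)) := by ring
      _ ≤ s / (2 * (n + 1)) * 1 := by gcongr
      _ = _ := mul_one _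
  · refine le_trans ?_ a2
    gcongr

lemma outer_bounds (n : ℕ) (m : ℝ) (hm : 0 ≤ m) :
    (∫ s in (0:ℝ)..m, ∫ t in (0:ℝ)..s,
        (besselK ((n : ℤ) + 1) s) ^ 2 * (besselI n t) ^ 2 * s * t) ≤ m ^ 2 / (4 * (n + 1)) ∧
    (∫ s in (0:ℝ)..m, ∫ t in (0:ℝ)..s,
        (besselK ((n : ℤ) + 1) s) ^ 2 * (besselI n t) ^ 2 * s * t) ≤ m := by
  constructor
  · refine (le_abs_self _).trans ?_
    have h := intervalIntegral.norm_integral_le_of_norm_le (μ := volume) hm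
      (f := fun s => ∫ t in (0:ℝ)..s,
        (besselK ((n : ℤ) + 1) s) ^ 2 * (besselI n t) ^ 2 * s * t)
      (g := fun s => s / (2 * (n + 1)))
      (Eventually.of_forall fun s hs => by
        have := inner_bounds n s hs.1
        rw [Real.norm_of_nonneg this.1]
        exact this.2.1)
      ((by fun_prop : Continuous _).intervalIntegrable _ _)
    refine h.trans (le_of_eq ?_)
    rw [intervalIntegral.integral_div, integral_id]
    field_simp
    ring
  · refine (le_abs_self _).trans ?_
    have h := intervalIntegral.norm_integral_le_of_norm_le (μ := volume) hm
      (f := fun s => ∫ t in (0:ℝ)..s,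
        (besselK ((n : ℤ) + 1) s) ^ 2 * (besselI n t) ^ 2 * s * t)
      (g := fun _ => 1)
      (Eventually.of_forall fun s hs => by
        have := inner_bounds n s hs.1
        rw [Real.norm_of_nonneg this.1]
        exact this.2.2)
      (by simp)
    refine h.trans (le_of_eq ?_)
    simp

/-- For integers `m ≥ 1`, `n ≥ 1`, the double integral
`∫_0^m ∫_0^s K_{n+1}(s)²·I_n(t)²·s·t dt ds` is bounded by `m²/(4n)` and by `m`;
moreover, for `n = 0` and `m ≥ 1`, `∫_0^m ∫_0^s K_1(s)²·I_0(t)²·s·t dt ds ≤ m`. -/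
theorem double_integral_bessel_bounds :
    (∀ m n : ℤ, 1 ≤ m → 1 ≤ n →
      (∫ s in (0:ℝ)..(m : ℝ), ∫ t in (0:ℝ)..s,
          (besselK (n + 1) s) ^ 2 * (besselI n t) ^ 2 * s * t)
        ≤ (m : ℝ) ^ 2 / (4 * (n : ℝ)) ∧
      (∫ s in (0:ℝ)..(m : ℝ), ∫ t in (0:ℝ)..s,
          (besselK (n + 1) s) ^ 2 * (besselI n t) ^ 2 * s * t)
        ≤ (m : ℝ)) ∧
    (∀ m : ℤ, 1 ≤ m →
      (∫ s in (0:ℝ)..(m : ℝ), ∫ t in (0:ℝ)..s,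
          (besselK 1 s) ^ 2 * (besselI 0 t) ^ 2 * s * t)
        ≤ (m : ℝ)) := by
  refine ⟨fun m n hm hn => ?_, fun m hm => ?_⟩
  · lift n to ℕ using by omega
    have hm' : (0:ℝ) ≤ m := by exact_mod_cast (by omega : (0:ℤ) ≤ m)
    have hn' : (1:ℝ) ≤ n := by exact_mod_cast hn
    obtain ⟨h1, h2⟩ := outer_bounds n m hm'
    refine ⟨h1.trans ?_, h2⟩
    rw [Int.cast_natCast]
    gcongr
    linarith
  · have hm' : (0:ℝ) ≤ m := by exact_mod_cast (by omega : (0:ℤ) ≤ m)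
    simpa using (outer_bounds 0 m hm').2
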